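/- The number of cycles in the 3×3 grid graph (4 rows and 4 columns of vertices) is 213. -/

import Mathlib

/-- The `L×N` lattice: grid graph with `L+1` rows and `N+1` columns of vertices. -/
def gridGraph (L N : ℕ) : SimpleGraph (Fin (L + 1) × Fin (N + 1)) :=
  SimpleGraph.fromRel (fun a b =>
    (a.1 = b.1 ∧ (a.2 : ℕ) + 1 = (b.2 : ℕ)) ∨ (a.2 = b.2 ∧ (a.1 : ℕ) + 1 = (b.1 : ℕ)))

/-- The set of edge sets of simple cycles (self-avoiding polygons) in a graph. -/
def cycleEdgeSets {V : Type} [DecidableEq V] (G : SimpleGraph V) : Set (Finset (Sym2 V)) :=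
  {s | ∃ (v : V) (w : G.Walk v v), w.IsCycle ∧ s = w.edges.toFinset}

/-- The number of simple cycles in a graph. -/
noncomputable def numCycles {V : Type} [DecidableEq V] (G : SimpleGraph V) : ℕ :=
  (cycleEdgeSets G).ncard

section CycleEnumeration

variable {V : Type}

/-- The edge lists of the nonempty paths of length at most `n` from `u` to `t` whose vertices
after `u` avoid `vis`, where `nb` lists the neighbors of each vertex. -/
def pathEdgeLists [DecidableEq V] (nb : V → List V) (t : V) : ℕ → V → List V → List (List (Sym2 V))
  | 0, _, _ => []
  | n + 1, u, vis => (nb u).flatMap fun x =>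
      if x ∈ vis then []
      else if x = t then [[s(u, x)]]
      else (pathEdgeLists nb t n x (x :: vis)).map (s(u, x) :: ·)

theorem mem_pathEdgeLists [DecidableEq V] {G : SimpleGraph V} {nb : V → List V}
    (hnb : ∀ u x, x ∈ nb u ↔ G.Adj u x) (t : V) (n : ℕ) (u : V) (vis : List V)
    (hut : u ≠ t) (hu : u ∈ vis) (l : List (Sym2 V)) :
    l ∈ pathEdgeLists nb t n u vis ↔ ∃ p : G.Walk u t, p.IsPath ∧ p.length ≤ n ∧
      (∀ x ∈ p.support.tail, x ∉ vis) ∧ l = p.edges := by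
  induction n generalizing u vis l with
  | zero =>
    simp only [pathEdgeLists, List.not_mem_nil, false_iff]
    rintro ⟨p, -, hp, -⟩
    exact hut (SimpleGraph.Walk.eq_of_length_eq_zero (Nat.le_zero.mp hp))
  | succ n ih =>
    simp only [pathEdgeLists, List.mem_flatMap]
    constructor
    · rintro ⟨x, hx, hl⟩
      rw [hnb] at hx
      split_ifs at hl with h1 h2
      · simp at hl
      · subst h2
        refine ⟨.cons hx .nil, ?_, ?_, ?_, ?_⟩
        · simpa using hut
        · simp
        · simpa using h1
        · simpa using hl
      · obtain ⟨l', hl', rfl⟩ := List.mem_map.mp hl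
        obtain ⟨q, hq, hqn, hqv, rfl⟩ := (ih x (x :: vis) h2 (by simp) l').mp hl'
        have hs : ∀ y ∈ q.support, y ∉ vis := by
          intro y hy
          rw [q.mem_support_iff] at hy
          rcases hy with rfl | hy
          · exact h1
          · exact fun h => hqv y hy (List.mem_cons_of_mem _ h)
        refine ⟨.cons hx q, ?_, ?_, ?_, ?_⟩
        · exact hq.cons fun h => hs u h hu
        · simpa using hqn
        · simpa using hs
        · simp
    · rintro ⟨p, hp, hpn, hpv, rfl⟩
      cases p with
      | nil => exact absurd rfl hut
      | @cons _ x _ h q =>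
        rw [SimpleGraph.Walk.cons_isPath_iff] at hp
        simp only [SimpleGraph.Walk.support_cons, List.tail_cons] at hpv
        have hx : x ∉ vis := hpv x q.start_mem_support
        refine ⟨x, (hnb _ _).mpr h, ?_⟩
        rw [if_neg hx]
        split_ifs with h2
        · subst h2
          have := (SimpleGraph.Walk.isPath_iff_nil.mp hp.1).eq_nil
          subst this
          simp
        · refine List.mem_map.mpr ⟨q.edges, (ih x (x :: vis) h2 (by simp) _).mpr
            ⟨q, hp.1, by simpa using hpn, ?_, rfl⟩, by simp⟩
          intro y hy
          have hnd := hp.1.support_nodup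
          rw [← q.cons_tail_support, List.nodup_cons] at hnd
          rw [List.mem_cons, not_or]
          exact ⟨fun h => hnd.1 (h ▸ hy), hpv y (List.mem_of_mem_tail hy)⟩

/-- The code of an unordered pair determined by vertex codes below `m`. -/
def pairCode (key : V → ℕ) (m : ℕ) : Sym2 V → ℕ :=
  Sym2.lift ⟨fun a b => min (key a) (key b) * m + max (key a) (key b),
    fun a b => by simp only [min_comm, max_comm]⟩

theorem pairCode_injective {key : V → ℕ} {m : ℕ} (hkey : Function.Injective key)
    (hm : ∀ v, key v < m) : Function.Injective (pairCode key m) := by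
  intro e f
  induction e with | _ a b
  induction f with | _ c d
  simp only [pairCode, Sym2.lift_mk, Sym2.eq_iff, ← hkey.eq_iff]
  intro h
  have h1 : max (key a) (key b) < m := max_lt (hm a) (hm b)
  have h2 : max (key c) (key d) < m := max_lt (hm c) (hm d)
  have hmod := congrArg (· % m) h
  have hdiv := congrArg (· / m) h
  have h0 : 0 < m := by omega
  simp only [Nat.mod_eq_of_lt h1, Nat.mod_eq_of_lt h2,
    Nat.mul_comm _ m, Nat.mul_add_mod, Nat.mul_add_div h0, Nat.div_eq_of_lt h1,
    Nat.div_eq_of_lt h2] at hmod hdiv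
  omega

/-- The edge lists of the cycles of length at most `n + 1`, each traversed from its vertex of
least key in both directions; `vs` lists all vertices. -/
def cycleEdgeLists [DecidableEq V] (nb : V → List V) (vs : List V) (key : V → ℕ) (m n : ℕ) :
    List (List (Sym2 V)) :=
  vs.flatMap fun t =>
    let low := vs.filter (key · < key t)
    (nb t).flatMap fun u =>
      if u ∈ low then []
      else ((pathEdgeLists nb t n u (u :: low)).filter fun l =>
        pairCode key m s(t, u) ∉ l.map (pairCode key m)).map (s(t, u) :: ·)

theorem mem_cycleEdgeLists [Fintype V] [DecidableEq V] {G : SimpleGraph V} {nb : V → List V}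
    (hnb : ∀ u x, x ∈ nb u ↔ G.Adj u x) {vs : List V} (hvs : ∀ v, v ∈ vs) {key : V → ℕ} {m n : ℕ}
    (hkey : Function.Injective key) (hm : ∀ v, key v < m) (hn : Fintype.card V ≤ n + 1)
    (l : List (Sym2 V)) :
    l ∈ cycleEdgeLists nb vs key m n ↔ ∃ (t : V) (w : G.Walk t t), w.IsCycle ∧
      (∀ x ∈ w.support, key t ≤ key x) ∧ l = w.edges := by
  have hc := pairCode_injective hkey hm
  simp only [cycleEdgeLists, List.mem_flatMap, hvs, true_and]
  refine exists_congr fun t => ?_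
  constructor
  · rintro ⟨u, hu, hl⟩
    rw [hnb] at hu
    split_ifs at hl with h1
    · simp at hl
    simp only [List.mem_map, List.mem_filter, decide_eq_true_eq] at hl
    obtain ⟨l', ⟨hl', hne⟩, rfl⟩ := hl
    obtain ⟨p, hp, -, hpv, rfl⟩ := (mem_pathEdgeLists hnb t n u _ hu.ne' (by simp) l').mp hl'
    refine ⟨.cons hu p, (SimpleGraph.Walk.cons_isCycle_iff p hu).mpr
      ⟨hp, fun h => hne ⟨_, h, rfl⟩⟩, ?_, by simp⟩
    intro x hx
    rw [SimpleGraph.Walk.support_cons, List.mem_cons, p.mem_support_iff] at hx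
    rcases hx with rfl | rfl | hx
    · rfl
    · simpa [hvs] using h1
    · have := hpv x hx
      simp only [List.mem_cons, List.mem_filter, hvs, not_or, true_and,
        decide_eq_true_eq, not_lt] at this
      exact this.2
  · rintro ⟨w, hw, hmin, rfl⟩
    cases w with
    | nil => exact absurd hw SimpleGraph.Walk.not_isCycle_nil
    | @cons _ u _ h p =>
      obtain ⟨hp, hne⟩ := (SimpleGraph.Walk.cons_isCycle_iff p h).mp hw
      have hmin' : ∀ x ∈ p.support, key t ≤ key x := fun x hx => hmin x (by simp [hx])
      refine ⟨u, (hnb _ _).mpr h, ?_⟩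
      rw [if_neg (by simpa [hvs] using hmin' u p.start_mem_support)]
      refine List.mem_map.mpr ⟨p.edges, List.mem_filter.mpr ⟨?_, ?_⟩, by simp⟩
      · refine (mem_pathEdgeLists hnb t n u _ h.ne' (by simp) _).mpr
          ⟨p, hp, by have := hp.length_lt; omega, ?_, rfl⟩
        intro x hx
        have hnd := hp.support_nodup
        rw [← p.cons_tail_support, List.nodup_cons] at hnd
        simp only [List.mem_cons, List.mem_filter, hvs, not_or, true_and,
          decide_eq_true_eq, not_lt]
        exact ⟨fun h => hnd.1 (h ▸ hx), hmin' x (List.mem_of_mem_tail hx)⟩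
      · rw [decide_eq_true_eq, List.mem_map_of_injective hc]
        exact hne

theorem cycleEdgeSets_eq [Fintype V] [DecidableEq V] {G : SimpleGraph V} {nb : V → List V}
    (hnb : ∀ u x, x ∈ nb u ↔ G.Adj u x) {vs : List V} (hvs : ∀ v, v ∈ vs) {key : V → ℕ} {m n : ℕ}
    (hkey : Function.Injective key) (hm : ∀ v, key v < m) (hn : Fintype.card V ≤ n + 1) :
    cycleEdgeSets G = ((cycleEdgeLists nb vs key m n).map List.toFinset).toFinset := by
  ext s
  simp only [List.coe_toFinset, List.mem_map, Set.mem_ofPred_eq, cycleEdgeSets,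
    mem_cycleEdgeLists hnb hvs hkey hm hn]
  constructor
  · rintro ⟨v, w, hw, rfl⟩
    obtain ⟨t, ht, hmin⟩ := w.support.toFinset.exists_min_image key ⟨v, by simp⟩
    rw [List.mem_toFinset] at ht
    refine ⟨_, ⟨t, w.rotate t ht, hw.rotate ht, fun x hx => hmin x ?_, rfl⟩, ?_⟩
    · rw [List.mem_toFinset]
      exact (SimpleGraph.Walk.mem_support_rotate_iff w t ht).mp hx
    · ext e
      simp [(w.rotate_edges t ht).perm.mem_iff]
  · rintro ⟨_, ⟨t, w, hw, -, rfl⟩, rfl⟩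
    exact ⟨t, w, hw, rfl⟩

theorem numCycles_eq [Fintype V] [DecidableEq V] {G : SimpleGraph V} {nb : V → List V}
    (hnb : ∀ u x, x ∈ nb u ↔ G.Adj u x) {vs : List V} (hvs : ∀ v, v ∈ vs) {key : V → ℕ} {m n : ℕ}
    (hkey : Function.Injective key) (hm : ∀ v, key v < m) (hn : Fintype.card V ≤ n + 1) :
    numCycles G = ((cycleEdgeLists nb vs key m n).map fun l =>
      (l.map fun e => 2 ^ pairCode key m e).sum).dedup.length := by
  have hinj : Function.Injective fun s : Finset (Sym2 V) => ∑ e ∈ s, 2 ^ pairCode key m e := by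
    intro s t h
    have hc := pairCode_injective hkey hm
    refine Finset.image_injective hc (Finset.geomSum_injective le_rfl ?_)
    simpa [Finset.sum_image hc.injOn] using h
  rw [numCycles, cycleEdgeSets_eq hnb hvs hkey hm hn, Set.ncard_coe_finset,
    ← Finset.card_image_of_injective _ hinj, ← List.card_toFinset]
  congr 1
  ext k
  simp only [Finset.mem_image, List.mem_toFinset, List.mem_map, exists_exists_and_eq_and]
  refine exists_congr fun l => and_congr_right fun hl => ?_
  obtain ⟨t, w, hw, -, rfl⟩ := (mem_cycleEdgeLists hnb hvs hkey hm hn l).mp hl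
  rw [List.sum_toFinset _ hw.edges_nodup]

end CycleEnumeration

/-- The neighbors of a vertex of the `3×3` lattice. -/
def gridNeighbors (a : Fin 4 × Fin 4) : List (Fin 4 × Fin 4) :=
  ((List.finRange 4).product (List.finRange 4)).filter fun b =>
    (a.1 = b.1 ∧ ((a.2 : ℕ) + 1 = b.2 ∨ (b.2 : ℕ) + 1 = a.2)) ∨
      (a.2 = b.2 ∧ ((a.1 : ℕ) + 1 = b.1 ∨ (b.1 : ℕ) + 1 = a.1))

theorem mem_gridNeighbors (a b : Fin 4 × Fin 4) :
    b ∈ gridNeighbors a ↔ (gridGraph 3 3).Adj a b := by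
  obtain ⟨i, j⟩ := a
  obtain ⟨k, l⟩ := b
  simp only [gridNeighbors, gridGraph, SimpleGraph.fromRel_adj, List.mem_filter,
    List.pair_mem_product, List.mem_finRange, decide_eq_true_eq, Prod.mk.injEq, ne_eq, Fin.ext_iff, and_self, true_and]
  omega

theorem numCycles_grid_3_3 : numCycles (gridGraph 3 3) = 213 := by
  rw [numCycles_eq (n := 15) (m := 16) (key := fun v => 4 * (v.1 : ℕ) + v.2)
    (vs := (List.finRange 4).product (List.finRange 4)) mem_gridNeighbors
    (fun v => List.pair_mem_product.mpr ⟨List.mem_finRange _, List.mem_finRange _⟩) ?_ (fun v => by omega) (by simp)]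
  · decide +kernel
  · rintro ⟨i, j⟩ ⟨k, l⟩ h
    simp only [Prod.mk.injEq, Fin.ext_iff] at h ⊢
    omega
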